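/- Let G be a directed multigraph with a fixed edge ordering e_1, …, e_m, and let w_G be the associated vertex weighting. Consider the semi-random graph process on [n], viewing each added edge as directed from the random vertex u_t (square) to the player's vertex v_t (circle). Then for any strategy S of the player, any t < n/2, and any vertex v ∈ V(G) with w = w_G(v), E|S(v, G; t)| ≤ (t^w / n^{w−1}) · (2·(w!)^D − 1), where D = max_{1 ≤ i ≤ m} diam(G_i) ≤ |V(G)| − 1. -/

import Mathlib

open Filter
open scoped ENNReal

namespace SemiRandomGraph

/-- One round of the semi-random graph process: the pair (square vertex, circle vertex),
i.e. the random vertex `u_t` together with the player's reply `v_t`. -/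
abbrev Step (n : ℕ) := Fin n × Fin n

/-- A strategy of the player: given the history of the process so far (most recent round
first) and the current random vertex `u_t`, a probability distribution for the reply `v_t`. -/
def Strategy (n : ℕ) := List (Step n) → Fin n → PMF (Fin n)

/-- The distribution of the history (most recent round first) after `t` rounds of the
semi-random graph process played with strategy `S`. -/
noncomputable def historyPMF {n : ℕ} (hn : 0 < n) (S : Strategy n) :
    ℕ → PMF (List (Step n))
  | 0 => PMF.pure []
  | t + 1 =>
      (historyPMF hn S t).bind fun h =>
        (@PMF.uniformOfFintype (Fin n) _ (Fin.pos_iff_nonempty.mp hn)).bind fun u =>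
          (S h u).map fun v => (u, v) :: h

/-- The multigraph built by the process (recorded by its history `h`) contains a subgraph
isomorphic to the simple graph `G`. -/
def ContainsCopy {V : Type*} {n : ℕ} (G : SimpleGraph V) (h : List (Step n)) : Prop :=
  ∃ φ : V ↪ Fin n, ∀ a b : V, G.Adj a b → ((φ a, φ b) ∈ h ∨ (φ b, φ a) ∈ h)

/-- The probability that after `t` rounds the multigraph `H_t` built with strategy `S`
contains a copy of `G`. -/
noncomputable def probContains {V : Type*} (n : ℕ) (S : Strategy n) (G : SimpleGraph V)
    (t : ℕ) : ℝ≥0∞ :=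
  if hn : 0 < n then (historyPMF hn S t).toOuterMeasure {h | ContainsCopy G h} else 0

/-- `G` is `d`-degenerate: every (induced, hence every) subgraph has a vertex of degree
at most `d`. -/
def Degen {V : Type*} (G : SimpleGraph V) [DecidableRel G.Adj] (d : ℕ) : Prop :=
  ∀ s : Finset V, s.Nonempty → ∃ v ∈ s, (s.filter fun u => G.Adj v u).card ≤ d

/-- `G` has degeneracy exactly `d`. -/
def DegeneracyEq {V : Type*} (G : SimpleGraph V) [DecidableRel G.Adj] (d : ℕ) : Prop :=
  Degen G d ∧ ∀ d' : ℕ, Degen G d' → d ≤ d'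

end SemiRandomGraph

namespace DirectedWeight

open scoped Classical

variable {V : Type*}

/-- There is a directed path (possibly empty) from `a` to `b` using the directed edges in
the list `es`. -/
def ReachIn (es : List (V × V)) (a b : V) : Prop :=
  Relation.ReflTransGen (fun u w => (u, w) ∈ es) a b

/-- Auxiliary weight function: the input list holds the edges in *reverse* order (most
recent edge `e_i` first).  Adding the edge `e_i = (x, y)` increases the weight of `x`
by one and raises the weight of every vertex reachable from `x` to at least the new
weight of `x`. -/
noncomputable def weightAux : List (V × V) → V → ℕ
  | [], _ => 0
  | (x, y) :: es, v =>
      if v = x then weightAux es x + 1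
      else if ReachIn ((x, y) :: es) x v then max (weightAux es x + 1) (weightAux es v)
      else weightAux es v

/-- The weight function `w_G` associated to a directed multigraph given by its edge list
`es = [e_1, …, e_m]` (in this order). -/
noncomputable def weight (es : List (V × V)) : V → ℕ := weightAux es.reverse

/-- The (undirected) degree of `v` in the directed multigraph with edge list `es`; a loop
at `v` contributes one. -/
noncomputable def degree (es : List (V × V)) (v : V) : ℕ :=
  (es.filter fun p => decide (p.1 = v ∨ p.2 = v)).length

end DirectedWeight

namespace DirectedWeight

/-- There is a directed path of length exactly `L` from `a` to `b` in the relation `R`. -/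
def HasPathRel {V : Type*} (R : V → V → Prop) (a b : V) (L : ℕ) : Prop :=
  ∃ f : ℕ → V, f 0 = a ∧ f L = b ∧ ∀ i < L, R (f i) (f (i + 1))

/-- The directed distance from `a` to `b` in the relation `R`. -/
noncomputable def relDist {V : Type*} (R : V → V → Prop) (a b : V) : ℕ :=
  sInf {L | HasPathRel R a b L}

/-- The diameter of the directed graph given by the relation `R`: the maximum of the
shortest-path distance over ordered pairs joined by a directed path (`0` if there are
none). -/
noncomputable def relDiam {V : Type*} (R : V → V → Prop) : ℕ :=
  sSup {L | ∃ a b : V, (∃ L', HasPathRel R a b L') ∧ L = relDist R a b}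

end DirectedWeight

namespace SemiRandomGraph

open DirectedWeight

/-- A homomorphism from the directed multigraph with ordered edge list `es` into the
history `h` of the semi-random graph process (most recent round first): an injection `φ`
on the vertices together with an assignment of rounds, respecting orientations and such
that the image of `e_i` is added before the image of `e_j` whenever `i < j`. -/
def IsHom {V : Type*} {n : ℕ} (es : List (V × V)) (h : List (Step n))
    (φ : V ↪ Fin n) : Prop :=
  ∃ τ : Fin es.length → Fin h.length,
    (∀ i j : Fin es.length, i < j → τ j < τ i) ∧
    ∀ i : Fin es.length, h.get (τ i) = (φ (es.get i).1, φ (es.get i).2)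

/-- The expected size of `S(v, G; t)`, the set of vertices of `H_t` that are the image of
`v` under some homomorphism from `G` (given by the ordered edge list `es`) to `H_t`. -/
noncomputable def expS {V : Type*} {n : ℕ} (hn : 0 < n) (S : Strategy n)
    (es : List (V × V)) (v : V) (t : ℕ) : ℝ≥0∞ :=
  ∑' h : List (Step n),
    historyPMF hn S t h *
      (Nat.card {u : Fin n | ∃ φ : V ↪ Fin n, IsHom es h φ ∧ φ v = u} : ℝ≥0∞)

end SemiRandomGraph

namespace SemiRandomGraph

open DirectedWeight

section Helpers

open scoped Classical

/-- Expectation of a natural-valued function of the history after `t` rounds. -/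
noncomputable def EE {n : ℕ} (hn : 0 < n) (S : Strategy n) (t : ℕ) (f : List (Step n) → ℕ) :
    ℝ≥0∞ :=
  ∑' h : List (Step n), historyPMF hn S t h * (f h : ℝ≥0∞)

theorem tsum_bind_mul {α β : Type*} (p : PMF α) (q : α → PMF β) (f : β → ℝ≥0∞) :
    ∑' b, (p.bind q) b * f b = ∑' a, p a * ∑' b, q a b * f b := by
  simp only [PMF.bind_apply, ← ENNReal.tsum_mul_right, ← ENNReal.tsum_mul_left]
  rw [ENNReal.tsum_comm]
  simp only [mul_assoc]

theorem tsum_pure_mul {β : Type*} (a : β) (f : β → ℝ≥0∞) :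
    ∑' b, (PMF.pure a) b * f b = f a := by
  rw [tsum_eq_single a]
  · simp
  · intro b hb
    simp [hb]

theorem tsum_map_mul {α β : Type*} (p : PMF α) (g : α → β) (f : β → ℝ≥0∞) :
    ∑' b, (p.map g) b * f b = ∑' a, p a * f (g a) := by
  rw [PMF.map, tsum_bind_mul]
  simp only [Function.comp, tsum_pure_mul]

variable {n : ℕ} (hn : 0 < n) (S : Strategy n)

theorem EE_mono {t : ℕ} {f g : List (Step n) → ℕ} (hfg : ∀ h, f h ≤ g h) :
    EE hn S t f ≤ EE hn S t g :=
  ENNReal.tsum_le_tsum fun h => by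
    have : (f h : ℝ≥0∞) ≤ g h := by exact_mod_cast hfg h
    gcongr

theorem EE_const {t : ℕ} (c : ℕ) : EE hn S t (fun _ => c) = c := by
  rw [EE, ENNReal.tsum_mul_right, PMF.tsum_coe, one_mul]

theorem EE_add {t : ℕ} (f g : List (Step n) → ℕ) :
    EE hn S t (fun h => f h + g h) = EE hn S t f + EE hn S t g := by
  simp only [EE, Nat.cast_add, mul_add, ENNReal.tsum_add]

theorem EE_mul {t : ℕ} (c : ℕ) (f : List (Step n) → ℕ) :
    EE hn S t (fun h => c * f h) = c * EE hn S t f := by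
  simp only [EE, Nat.cast_mul, ← ENNReal.tsum_mul_left]
  refine tsum_congr fun h => ?_
  ring

theorem EE_zero (f : List (Step n) → ℕ) : EE hn S 0 f = f [] := by
  rw [EE, historyPMF, tsum_pure_mul]

theorem EE_succ_le {t : ℕ} (f : List (Step n) → ℕ) (A : List (Step n) → Finset (Fin n))
    (hf : ∀ h a b, f ((a, b) :: h) ≤ f h + if a ∈ A h then 1 else 0) :
    EE hn S (t + 1) f ≤ EE hn S t f + (n : ℝ≥0∞)⁻¹ * EE hn S t (fun h => (A h).card) := by
  rw [EE, historyPMF, tsum_bind_mul]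
  simp only [EE]
  rw [← ENNReal.tsum_mul_left, ← ENNReal.tsum_add]
  refine ENNReal.tsum_le_tsum fun h => ?_
  rw [tsum_bind_mul]
  simp only [tsum_map_mul]
  have h1 : ∀ u : Fin n, ∑' v, S h u v * (f ((u, v) :: h) : ℝ≥0∞) ≤
      (f h : ℝ≥0∞) + if u ∈ A h then 1 else 0 := by
    intro u
    calc ∑' v, S h u v * (f ((u, v) :: h) : ℝ≥0∞)
        ≤ ∑' v, S h u v * ((f h : ℝ≥0∞) + if u ∈ A h then 1 else 0) := by
          refine ENNReal.tsum_le_tsum fun v => ?_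
          have : (f ((u, v) :: h) : ℝ≥0∞) ≤ (f h : ℝ≥0∞) + if u ∈ A h then 1 else 0 := by
            exact_mod_cast hf h u v
          gcongr
      _ = _ := by rw [ENNReal.tsum_mul_right, PMF.tsum_coe, one_mul]
  have hn0 : (n : ℝ≥0∞) ≠ 0 := by exact_mod_cast hn.ne'
  have hnt : (n : ℝ≥0∞) ≠ ⊤ := ENNReal.natCast_ne_top n
  have h2 : ∑ u : Fin n, (n : ℝ≥0∞)⁻¹ * ((f h : ℝ≥0∞) + if u ∈ A h then 1 else 0) =
      f h + (n : ℝ≥0∞)⁻¹ * (A h).card := by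
    rw [← Finset.mul_sum, Finset.sum_add_distrib, mul_add]
    congr 1
    · simp only [Finset.sum_const, Finset.card_univ, Fintype.card_fin, nsmul_eq_mul]
      rw [← mul_assoc, ENNReal.inv_mul_cancel hn0 hnt, one_mul]
    · simp
  calc _ ≤ historyPMF hn S t h *
        ∑' u : Fin n, (n : ℝ≥0∞)⁻¹ * ((f h : ℝ≥0∞) + if u ∈ A h then 1 else 0) := by
          gcongr with u
          · simp [PMF.uniformOfFintype_apply]
          · exact h1 u
    _ = _ := by
          rw [tsum_fintype, h2]
          ring

/-- The main term of the bound. -/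
noncomputable def bet (n w t : ℕ) : ℝ≥0∞ := n * ((t : ℝ≥0∞) * (n : ℝ≥0∞)⁻¹) ^ w

theorem bet_succ {n : ℕ} (hn : 0 < n) (w t : ℕ) :
    bet n (w + 1) t + (n : ℝ≥0∞)⁻¹ * bet n w t ≤ bet n (w + 1) (t + 1) := by
  have hn0 : (n : ℝ≥0∞) ≠ 0 := by exact_mod_cast hn.ne'
  have hnt : (n : ℝ≥0∞) ≠ ⊤ := ENNReal.natCast_ne_top n
  have e1 : bet n (w + 1) t + (n : ℝ≥0∞)⁻¹ * bet n w t
      = (n : ℝ≥0∞) * ((n : ℝ≥0∞)⁻¹) ^ (w + 1) * ((t : ℝ≥0∞) ^ w * (t + 1)) := by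
    simp only [bet, mul_pow]; ring
  have e2 : bet n (w + 1) (t + 1)
      = (n : ℝ≥0∞) * ((n : ℝ≥0∞)⁻¹) ^ (w + 1) * (((t : ℝ≥0∞) + 1) ^ w * (t + 1)) := by
    simp only [bet, mul_pow]; push_cast; ring
  rw [e1, e2]
  gcongr
  exact le_self_add

theorem bet_anti (w t : ℕ) (ht : t ≤ n) : bet n (w + 1) t ≤ bet n w t := by
  have : (t : ℝ≥0∞) * (n : ℝ≥0∞)⁻¹ ≤ 1 := by
    rw [← div_eq_mul_inv]
    refine ENNReal.div_le_of_le_mul ?_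
    rw [one_mul]; exact_mod_cast ht
  unfold bet
  rw [pow_succ]
  gcongr
  exact mul_le_of_le_one_right' this

theorem growth {w : ℕ} {c : ℝ≥0∞} (f : List (Step n) → ℕ) (A : List (Step n) → Finset (Fin n))
    (f0 : f [] = 0) (hf : ∀ h a b, f ((a, b) :: h) ≤ f h + if a ∈ A h then 1 else 0)
    (t : ℕ) (hA : ∀ s < t, EE hn S s (fun h => (A h).card) ≤ bet n w s * c) :
    EE hn S t f ≤ bet n (w + 1) t * c := by
  induction t with
  | zero => simp [EE_zero, f0]
  | succ t ih =>
    calc EE hn S (t + 1) f ≤ EE hn S t f + (n : ℝ≥0∞)⁻¹ * EE hn S t (fun h => (A h).card) :=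
          EE_succ_le hn S f A hf
      _ ≤ bet n (w + 1) t * c + (n : ℝ≥0∞)⁻¹ * (bet n w t * c) := by
          gcongr
          · exact ih fun s hs => hA s (by omega)
          · exact hA t (by omega)
      _ = (bet n (w + 1) t + (n : ℝ≥0∞)⁻¹ * bet n w t) * c := by ring
      _ ≤ _ := by gcongr; exact bet_succ hn w t

/-- Number of rounds in which `u` was the square. -/
noncomputable def outdeg (h : List (Step n)) (u : Fin n) : ℕ := h.countP fun s => s.1 = u

theorem outdeg_cons (h : List (Step n)) (a b u : Fin n) :
    outdeg ((a, b) :: h) u = outdeg h u + if a = u then 1 else 0 := by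
  simp [outdeg, List.countP_cons]

/-- Vertices of outdegree at least `k`. -/
noncomputable def bigDeg (k : ℕ) (h : List (Step n)) : Finset (Fin n) :=
  Finset.univ.filter fun u => k ≤ outdeg h u

/-- Total excess of outdegrees over `w`. -/
noncomputable def excess (w : ℕ) (h : List (Step n)) : ℕ := ∑ u, (outdeg h u - w)

theorem EE_bigDeg (k t : ℕ) : EE hn S t (fun h => (bigDeg k h).card) ≤ bet n k t * 1 := by
  induction k generalizing t with
  | zero =>
    refine (EE_mono hn S (g := fun _ => n) fun h => ?_).trans ?_
    · simpa using Finset.card_le_univ (bigDeg 0 h)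
    · simp [EE_const, bet]
  | succ k ih =>
    refine growth hn S _ (bigDeg k) ?_ ?_ t fun s _ => ih s
    · simp [bigDeg, outdeg]
    · intro h a b
      have : bigDeg (k + 1) ((a, b) :: h) ⊆
          bigDeg (k + 1) h ∪ if a ∈ bigDeg k h then {a} else ∅ := by
        intro u hu
        simp only [bigDeg, Finset.mem_filter, Finset.mem_univ, true_and, outdeg_cons,
          Finset.mem_union] at hu ⊢
        by_cases hau : a = u
        · subst hau
          right
          rw [if_pos (by simpa using hu)]
          simp
        · left; simpa [hau] using hu
      refine (Finset.card_le_card this).trans ((Finset.card_union_le _ _).trans ?_)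
      gcongr
      split_ifs <;> simp

theorem EE_excess (w t : ℕ) : EE hn S t (excess w) ≤ bet n (w + 1) t * 1 := by
  refine growth hn S _ (bigDeg w) ?_ ?_ t fun s _ => EE_bigDeg hn S w s
  · simp [excess, outdeg]
  · intro h a b
    have : ∀ u, outdeg ((a, b) :: h) u - w ≤
        (outdeg h u - w) + if a = u then (if a ∈ bigDeg w h then 1 else 0) else 0 := by
      intro u
      rw [outdeg_cons]
      by_cases hau : a = u
      · subst hau
        by_cases hb : w ≤ outdeg h a
        · simp [bigDeg, hb]; omega
        · simp [bigDeg, hb]; omega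
      · simp [hau]
    refine (Finset.sum_le_sum fun u _ => this u).trans ?_
    rw [Finset.sum_add_distrib]
    simp [excess]

variable {V : Type*}

/-- Images of `v` under order preserving embeddings (edge list in reverse order). -/
noncomputable def img (res : List (V × V)) (v : V) (h : List (Step n)) : Finset (Fin n) :=
  Finset.univ.filter fun u => ∃ φ : V ↪ Fin n, φ v = u ∧
    (res.map fun e => ((φ e.1, φ e.2) : Step n)).Sublist h

theorem IsHom.sublist {es : List (V × V)} {h : List (Step n)} {φ : V ↪ Fin n}
    (hom : IsHom es h φ) :
    (es.reverse.map fun e => ((φ e.1, φ e.2) : Step n)).Sublist h := by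
  obtain ⟨τ, hτ, hget⟩ := hom
  rw [List.sublist_iff_exists_fin_orderEmbedding_get_eq]
  have hl : (es.reverse.map fun e => ((φ e.1, φ e.2) : Step n)).length = es.length := by simp
  refine ⟨OrderEmbedding.ofStrictMono (fun i => τ (Fin.rev (Fin.cast hl i))) ?_, ?_⟩
  · intro i j hij
    apply hτ
    rw [Fin.rev_lt_rev]
    exact hij
  · intro i
    have := hget (Fin.rev (Fin.cast hl i))
    change _ = h.get (τ (Fin.rev (Fin.cast hl i)))
    rw [this]
    have hidx : es.length - 1 - (i : ℕ) = es.length - ((i : ℕ) + 1) := by omega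
    simp [List.getElem_reverse, Fin.val_rev, hidx]

theorem img_step (res : List (V × V)) (x y : V) (h : List (Step n)) (a b : Fin n) :
    (img ((x, y) :: res) x ((a, b) :: h)).card ≤
      (img ((x, y) :: res) x h).card + if a ∈ img res x h then 1 else 0 := by
  have : img ((x, y) :: res) x ((a, b) :: h) ⊆
      img ((x, y) :: res) x h ∪ if a ∈ img res x h then {a} else ∅ := by
    intro u hu
    simp only [img, Finset.mem_filter, Finset.mem_univ, true_and, Finset.mem_union,
      List.map_cons] at hu ⊢
    obtain ⟨φ, rfl, hs⟩ := hu
    rw [List.cons_sublist_cons'] at hs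
    rcases hs with hs | ⟨he, hs⟩
    · exact Or.inl ⟨φ, rfl, hs⟩
    · right
      simp only [Prod.mk.injEq] at he
      rw [if_pos ⟨φ, he.1, hs⟩]
      simp [he.1]
  refine (Finset.card_le_card this).trans ((Finset.card_union_le _ _).trans ?_)
  gcongr
  split_ifs <;> simp

theorem img_tail (res : List (V × V)) (e : V × V) (v : V) (h : List (Step n)) :
    (img (e :: res) v h).card ≤ (img res v h).card := by
  refine Finset.card_le_card fun u hu => ?_
  simp only [img, Finset.mem_filter, Finset.mem_univ, true_and] at hu ⊢
  obtain ⟨φ, rfl, hs⟩ := hu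
  exact ⟨φ, rfl, ((List.sublist_cons_self _ _).map _).trans hs⟩

theorem img_nbr {res : List (V × V)} {p q : V} (hpq : (p, q) ∈ res) (w : ℕ)
    (h : List (Step n)) :
    (img res q h).card ≤ w * (img res p h).card + excess w h := by
  have hsub : img res q h ⊆ (img res p h).biUnion fun u =>
      ((h.filter fun s => s.1 = u).map Prod.snd).toFinset := by
    intro z hz
    simp only [img, Finset.mem_filter, Finset.mem_univ, true_and, Finset.mem_biUnion,
      List.mem_toFinset, List.mem_map, List.mem_filter, decide_eq_true_eq] at hz ⊢
    obtain ⟨φ, rfl, hs⟩ := hz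
    exact ⟨φ p, ⟨φ, rfl, hs⟩, (φ p, φ q),
      ⟨hs.subset (List.mem_map.mpr ⟨(p, q), hpq, rfl⟩), rfl⟩, rfl⟩
  calc (img res q h).card ≤ ∑ u ∈ img res p h,
        (((h.filter fun s => s.1 = u).map Prod.snd).toFinset).card :=
        (Finset.card_le_card hsub).trans Finset.card_biUnion_le
    _ ≤ ∑ u ∈ img res p h, (w + (outdeg h u - w)) := by
        refine Finset.sum_le_sum fun u _ => ?_
        refine (List.toFinset_card_le _).trans ?_
        rw [List.length_map, ← List.countP_eq_length_filter]
        change outdeg h u ≤ _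
        omega
    _ = w * (img res p h).card + ∑ u ∈ img res p h, (outdeg h u - w) := by
        rw [Finset.sum_add_distrib, Finset.sum_const, smul_eq_mul, mul_comm]
    _ ≤ _ := by
        gcongr
        exact Finset.sum_le_sum_of_subset (Finset.subset_univ _)

theorem img_le_length {res : List (V × V)} {p q : V} (hpq : (p, q) ∈ res)
    (h : List (Step n)) : (img res q h).card ≤ h.length := by
  have hsub : img res q h ⊆ (h.map Prod.snd).toFinset := by
    intro z hz
    simp only [img, Finset.mem_filter, Finset.mem_univ, true_and] at hz
    obtain ⟨φ, rfl, hs⟩ := hz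
    rw [List.mem_toFinset]
    exact List.mem_map.mpr ⟨(φ p, φ q), hs.subset (List.mem_map.mpr ⟨(p, q), hpq, rfl⟩), rfl⟩
  refine (Finset.card_le_card hsub).trans ((List.toFinset_card_le _).trans ?_)
  simp

theorem EE_length (t : ℕ) : EE hn S t List.length ≤ bet n 1 t * 1 := by
  refine growth hn S _ (fun _ => Finset.univ) rfl ?_ t fun s _ => ?_
  · intro h a b; simp
  · simp [EE_const, bet]

/-- Diameter condition along all stages of the construction. -/
def DiamLe (D : ℕ) (res : List (V × V)) : Prop :=
  ∀ r, r <:+ res → ∀ a b, ReachIn r a b → ∃ L ≤ D, HasPathRel (fun u w => (u, w) ∈ r) a b L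

theorem cst_mono (D w : ℕ) :
    2 * (w.factorial : ℝ≥0∞) ^ D - 1 ≤ 2 * ((w + 1).factorial : ℝ≥0∞) ^ D - 1 := by
  gcongr
  omega

theorem cst_add (D w : ℕ) :
    2 * (w.factorial : ℝ≥0∞) ^ D - 1 + 1 = 2 * (w.factorial : ℝ≥0∞) ^ D := by
  refine tsub_add_cancel_of_le ?_
  have : 1 ≤ 2 * w.factorial ^ D := by
    have := Nat.pow_pos (n := D) w.factorial_pos
    omega
  exact_mod_cast this

theorem bet_ne_top (w t : ℕ) : bet n w t ≠ ⊤ := by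
  by_cases h : n = 0
  · subst h
    simp [bet]
  · unfold bet
    finiteness

theorem main_bound (D : ℕ) (res : List (V × V)) (hD : DiamLe D res) (v : V) (t : ℕ)
    (ht : t ≤ n) :
    EE hn S t (fun h => (img res v h).card) ≤
      bet n (weightAux res v) t * (2 * ((weightAux res v).factorial : ℝ≥0∞) ^ D - 1) := by
  induction res generalizing v t with
  | nil =>
    have hc : (2 : ℝ≥0∞) - 1 = 1 := by
      have := cst_add 0 0
      simpa using (ENNReal.sub_eq_of_eq_add (by simp) (by norm_num : (2 : ℝ≥0∞) = 1 + 1))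
    refine (EE_mono hn S (g := fun _ => n) fun h => ?_).trans ?_
    · simpa using Finset.card_le_univ (img ([] : List (V × V)) v h)
    · simp [EE_const, bet, weightAux, hc]
  | cons e res ih =>
    obtain ⟨x, y⟩ := e
    have hD' : DiamLe D res := fun r hr => hD r (hr.trans (List.suffix_cons _ _))
    have hx : ∀ t ≤ n, EE hn S t (fun h => (img ((x, y) :: res) x h).card) ≤
        bet n (weightAux res x + 1) t * (2 * ((weightAux res x).factorial : ℝ≥0∞) ^ D - 1) := by
      intro t ht
      refine growth hn S _ (fun h => img res x h) ?_ (img_step res x y) t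
        fun s hs => ih hD' x s (by omega)
      simp [img]
    have hold : EE hn S t (fun h => (img ((x, y) :: res) v h).card) ≤
        bet n (weightAux res v) t * (2 * ((weightAux res v).factorial : ℝ≥0∞) ^ D - 1) :=
      (EE_mono hn S fun h => img_tail res (x, y) v h).trans (ih hD' v t ht)
    rw [weightAux]
    split_ifs with h1 h2
    · subst h1
      refine (hx t ht).trans ?_
      exact mul_le_mul_right (cst_mono D _) _
    · rcases le_total (weightAux res x + 1) (weightAux res v) with hle | hle
      · rw [max_eq_right hle]; exact hold
      · rw [max_eq_left hle]
        obtain ⟨k, hk, f, f0, fk, hf⟩ := hD _ (List.suffix_refl _) x v h2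
        have hk0 : k ≠ 0 := by
          rintro rfl
          exact h1 (fk.symm.trans f0)
        by_cases hw : weightAux res x = 0
        · rw [hw]
          obtain ⟨j, rfl⟩ := Nat.exists_eq_succ_of_ne_zero hk0
          have hc : (2 : ℝ≥0∞) - 1 = 1 :=
            ENNReal.sub_eq_of_eq_add (by simp) (by norm_num : (2 : ℝ≥0∞) = 1 + 1)
          have hjv := hf j (by omega)
          rw [show j + 1 = j.succ from rfl, fk] at hjv
          refine (EE_mono hn S fun h => img_le_length hjv h).trans ((EE_length hn S t).trans ?_)
          simp [hc]
        · set w := weightAux res x + 1 with hwdef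
          have hw2 : 2 ≤ w := by omega
          have key : ∀ i ≤ k, EE hn S t (fun h => (img ((x, y) :: res) (f i) h).card) + bet n w t
              ≤ bet n w t * (w : ℝ≥0∞) ^ i * (2 * ((weightAux res x).factorial : ℝ≥0∞) ^ D) := by
            intro i
            induction i with
            | zero =>
              intro _
              rw [f0, ← cst_add]
              refine (add_le_add_left (hx t ht) _).trans (le_of_eq ?_)
              ring
            | succ i ihi =>
              intro hi
              have hstep : EE hn S t (fun h => (img ((x, y) :: res) (f (i + 1)) h).card) ≤
                  w * EE hn S t (fun h => (img ((x, y) :: res) (f i) h).card) + bet n w t := by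
                refine (EE_mono hn S fun h => img_nbr (hf i (by omega)) w h).trans ?_
                rw [EE_add, EE_mul]
                gcongr
                refine (EE_excess hn S w t).trans ?_
                rw [mul_one]
                exact bet_anti w t ht
              calc _ ≤ w * EE hn S t (fun h => (img ((x, y) :: res) (f i) h).card) + bet n w t
                    + bet n w t := by gcongr
                _ = w * EE hn S t (fun h => (img ((x, y) :: res) (f i) h).card)
                    + 2 * bet n w t := by ring
                _ ≤ w * EE hn S t (fun h => (img ((x, y) :: res) (f i) h).card)
                    + w * bet n w t := by
                    gcongr
                    exact_mod_cast hw2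
                _ = w * (EE hn S t (fun h => (img ((x, y) :: res) (f i) h).card)
                    + bet n w t) := by ring
                _ ≤ w * (bet n w t * (w : ℝ≥0∞) ^ i *
                    (2 * ((weightAux res x).factorial : ℝ≥0∞) ^ D)) := by
                    gcongr
                    exact ihi (by omega)
                _ = _ := by ring
          have hfin := key k le_rfl
          rw [fk] at hfin
          have hlast : EE hn S t (fun h => (img ((x, y) :: res) v h).card) + bet n w t ≤
              bet n w t * (2 * (w.factorial : ℝ≥0∞) ^ D - 1) + bet n w t := by
            refine hfin.trans ?_
            have e1 : bet n w t * (2 * (w.factorial : ℝ≥0∞) ^ D - 1) + bet n w t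
                = bet n w t * (2 * (w.factorial : ℝ≥0∞) ^ D) := by
              rw [← cst_add D w, mul_add, mul_one, cst_add D w]
            rw [e1, hwdef, Nat.factorial_succ, ← hwdef]
            push_cast [Nat.cast_mul]
            rw [mul_pow]
            have : (w : ℝ≥0∞) ^ k ≤ (w : ℝ≥0∞) ^ D := by
              have : w ^ k ≤ w ^ D := Nat.pow_le_pow_right (by omega) hk
              exact_mod_cast this
            calc _ ≤ bet n w t * (w : ℝ≥0∞) ^ D *
                  (2 * ((weightAux res x).factorial : ℝ≥0∞) ^ D) := by gcongr
              _ = _ := by ring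
          exact (ENNReal.add_le_add_iff_right (bet_ne_top w t)).mp hlast
    · exact hold

theorem hasPath_of_reach {R : V → V → Prop} {a b : V} (hab : Relation.ReflTransGen R a b) :
    ∃ L, HasPathRel R a b L := by
  induction hab with
  | refl => exact ⟨0, fun _ => a, rfl, rfl, by simp⟩
  | @tail b c _ hbc ih =>
    obtain ⟨L, f, f0, fL, hf⟩ := ih
    refine ⟨L + 1, fun i => if i ≤ L then f i else c, by simp [f0], by simp, ?_⟩
    intro i hi
    rcases Nat.lt_or_ge i L with h | h
    · simp only [h.le, if_true, Nat.succ_le_of_lt h]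
      exact hf i h
    · obtain rfl : i = L := by omega
      simp [fL, hbc]

theorem relDist_spec {R : V → V → Prop} {a b : V} (h : ∃ L, HasPathRel R a b L) :
    HasPathRel R a b (relDist R a b) := Nat.sInf_mem h

theorem relDist_lt [Fintype V] {R : V → V → Prop} {a b : V} (h : ∃ L, HasPathRel R a b L) :
    relDist R a b < Fintype.card V := by
  obtain ⟨f, f0, fL, hf⟩ := relDist_spec h
  set L := relDist R a b with hL
  have hmin : ∀ L', HasPathRel R a b L' → L ≤ L' := fun L' h' => Nat.sInf_le h'
  have hne : ∀ i j, i < j → j ≤ L → f i ≠ f j := by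
    intro i j hij hj heq
    have : HasPathRel R a b (L - (j - i)) := by
      refine ⟨fun k => if k ≤ i then f k else f (k + (j - i)), by simp [f0], ?_, ?_⟩
      · by_cases hc : L - (j - i) ≤ i
        · have : L = j := by omega
          have h2 : L - (j - i) = i := by omega
          simp only [h2, le_refl, if_true]
          rw [heq, ← this, fL]
        · simp only [hc, if_false]
          rw [show L - (j - i) + (j - i) = L by omega, fL]
      · intro k hk
        rcases lt_trichotomy k i with h1 | h1 | h1
        · simp only [h1.le, Nat.succ_le_of_lt h1, if_true]
          exact hf k (by omega)
        · subst h1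
          simp only [le_refl, if_true, show ¬ (k + 1 ≤ k) by omega, if_false]
          rw [heq, show k + 1 + (j - k) = j + 1 by omega]
          exact hf j (by omega)
        · simp only [show ¬ (k ≤ i) by omega, show ¬ (k + 1 ≤ i) by omega, if_false]
          rw [show k + 1 + (j - i) = k + (j - i) + 1 by omega]
          exact hf _ (by omega)
    have := hmin _ this
    omega
  have hinj : Function.Injective fun i : Fin (L + 1) => f i := by
    intro i j hij
    rcases lt_trichotomy i j with h1 | h1 | h1
    · exact absurd hij (hne i j h1 (by omega))
    · exact h1
    · exact absurd hij.symm (hne j i h1 (by omega))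
  have := Fintype.card_le_of_injective _ hinj
  simpa using this

theorem relDiam_le [Fintype V] (R : V → V → Prop) : relDiam R ≤ Fintype.card V - 1 := by
  refine csSup_le' ?_
  rintro L ⟨a, b, h, rfl⟩
  have := relDist_lt h
  omega

theorem relDist_le_relDiam [Fintype V] {R : V → V → Prop} {a b : V}
    (h : ∃ L, HasPathRel R a b L) : relDist R a b ≤ relDiam R := by
  refine le_csSup ⟨Fintype.card V, ?_⟩ ⟨a, b, h, rfl⟩
  rintro L ⟨a, b, h, rfl⟩
  exact (relDist_lt h).le

end Helpers

end SemiRandomGraph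

open SemiRandomGraph DirectedWeight in
/-- **Lemma 14.** Let `G` be a directed multigraph with ordered edge list `es` and
associated weighting `w_G`.  For any strategy of the player in the semi-random graph
process, any `t < n/2` and any vertex `v` of weight `w = w_G(v)`,
`E|S(v,G;t)| ≤ (t^w / n^{w-1}) (2 (w!)^D - 1)`, where
`D = max_i diam(G_i) ≤ |V(G)| - 1`. -/
theorem expected_images_le {V : Type*} [Fintype V] (es : List (V × V))
    {n : ℕ} (hn : 0 < n) (S : Strategy n) (t : ℕ) (ht : 2 * t < n)
    (v : V) (w D : ℕ) (hw : w = weight es v)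
    (hD : D = (Finset.range (es.length + 1)).sup
      fun i => relDiam fun a b : V => (a, b) ∈ es.take i) :
    D ≤ Fintype.card V - 1 ∧
    expS hn S es v t ≤
      (t : ℝ≥0∞) ^ w / (n : ℝ≥0∞) ^ ((w : ℤ) - 1) *
        (2 * (w.factorial : ℝ≥0∞) ^ D - 1) := by
  refine ⟨?_, ?_⟩
  · rw [hD]
    exact Finset.sup_le fun i _ => relDiam_le _
  · have hdiam : DiamLe D es.reverse := by
      intro r hr a b hab
      have hr' : r.reverse <+: es := by
        rw [← List.reverse_suffix, List.reverse_reverse]; exact hr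
      have htake := List.prefix_iff_eq_take.mp hr'
      have hp := hasPath_of_reach hab
      refine ⟨_, ?_, relDist_spec hp⟩
      refine (relDist_le_relDiam hp).trans ?_
      have hrel : (fun u w : V => (u, w) ∈ r) =
          fun u w : V => (u, w) ∈ es.take r.reverse.length := by
        rw [← htake]; simp
      rw [hrel, hD]
      exact Finset.le_sup (f := fun i => relDiam fun a b : V => (a, b) ∈ es.take i)
        (Finset.mem_range.mpr (Nat.lt_succ_of_le hr'.length_le))
    have hmain := main_bound hn S D es.reverse hdiam v t (by omega)
    have hn0 : (n : ℝ≥0∞) ≠ 0 := by exact_mod_cast hn.ne'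
    have hnt : (n : ℝ≥0∞) ≠ ⊤ := ENNReal.natCast_ne_top n
    have hbet : (t : ℝ≥0∞) ^ w / (n : ℝ≥0∞) ^ ((w : ℤ) - 1) = bet n w t := by
      rw [div_eq_mul_inv, ← ENNReal.zpow_neg, neg_sub, sub_eq_add_neg,
        ENNReal.zpow_add hn0 hnt, zpow_one, ENNReal.zpow_neg, zpow_natCast, bet, mul_pow,
        ENNReal.inv_pow]
      ring
    rw [hbet, hw]
    refine le_trans ?_ hmain
    refine ENNReal.tsum_le_tsum fun h => ?_
    gcongr
    change _ ≤ (img es.reverse v h).card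
    rw [Nat.card_coe_set_eq, ← Set.ncard_coe_finset]
    refine Set.ncard_le_ncard ?_ (Set.toFinite _)
    rintro u ⟨φ, hom, rfl⟩
    simp only [img, Finset.coe_filter, Finset.mem_univ, true_and, Set.mem_ofPred_eq]
    exact ⟨φ, rfl, hom.sublist⟩
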